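/- For every nonnegative integer i, every positive integer ω divisible by 2^{i+1}, and every proper deterministic online coloring algorithm A with unknown representation, there exists a finite sequence of closed intervals in ℝ, each of length at least 1 and at most 3·4^i, whose clique number is at most ω, such that when the associated interval graph is presented to A vertex by vertex in the order of the sequence, A uses at least 3·(1 − 2^{-(i+1)})·ω colors. -/

import Mathlib

/-- The interval graph determined by a finite sequence of closed intervals
(each given as a pair of endpoints): vertices `i` and `j` are adjacent iff the
corresponding closed intervals intersect. -/
def intervalGraph {n : ℕ} (x : Fin n → ℝ × ℝ) : SimpleGraph (Fin n) :=
  SimpleGraph.fromRel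
    (fun i j => (Set.Icc (x i).1 (x i).2 ∩ Set.Icc (x j).1 (x j).2).Nonempty)

/-- A deterministic online coloring algorithm with unknown representation:
it assigns to each finite simple graph on ordered vertex set `Fin (i+1)` a
color for the last vertex. -/
def OnlineAlg : Type := ∀ i : ℕ, SimpleGraph (Fin (i + 1)) → ℕ

/-- The coloring produced when a graph `G` on `Fin n` is presented to the
algorithm `A` vertex by vertex: vertex `i` is colored according to the
induced subgraph on the first `i+1` vertices. -/
def onlineColoring (A : OnlineAlg) {n : ℕ} (G : SimpleGraph (Fin n)) (i : Fin n) : ℕ :=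
  A i.1 (G.comap (Fin.castLE i.isLt))

/-- The algorithm `A` is proper: on every presented graph, adjacent vertices
receive distinct colors. -/
def IsProper (A : OnlineAlg) : Prop :=
  ∀ (n : ℕ) (G : SimpleGraph (Fin n)) (i j : Fin n),
    G.Adj i j → onlineColoring A G i ≠ onlineColoring A G j


namespace OnlineInterval

/-- An interval `[lo, hi]` lying on the copy of the real line numbered `line`. -/
structure Seg where
  line : ℕ
  lo : ℝ
  hi : ℝ

/-- Two segments meet if they lie on the same line and intersect there. -/
def Meets (v w : Seg) : Prop := v.line = w.line ∧ v.lo ≤ w.hi ∧ w.lo ≤ v.hi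

/-- The intersection graph of the first `n` segments. -/
def segGraph (x : ℕ → Seg) (n : ℕ) : SimpleGraph (Fin n) :=
  SimpleGraph.fromRel fun a b => Meets (x a) (x b)

/-- The color that `A` gives to the `j`-th segment. -/
def color (A : OnlineAlg) (x : ℕ → Seg) (j : ℕ) : ℕ := A j (segGraph x (j + 1))

lemma onlineColoring_segGraph (A : OnlineAlg) (x : ℕ → Seg) (n : ℕ) (j : Fin n) :
    onlineColoring A (segGraph x n) j = color A x j := by
  unfold onlineColoring color
  congr 1
  ext a b
  simp [segGraph, Fin.ext_iff]

lemma color_congr (A : OnlineAlg) {x y : ℕ → Seg} {j : ℕ}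
    (h : ∀ a ≤ j, ∀ b ≤ j, (Meets (x a) (x b) ↔ Meets (y a) (y b))) :
    color A x j = color A y j := by
  unfold color
  congr 1
  ext a b
  simp only [segGraph, SimpleGraph.fromRel_adj]
  rw [h a (by omega) b (by omega), h b (by omega) a (by omega)]

lemma color_ne {A : OnlineAlg} (hA : IsProper A) {x : ℕ → Seg} {i j : ℕ} (hij : i ≠ j)
    (h : Meets (x i) (x j)) : color A x i ≠ color A x j := by
  have := hA (max i j + 1) (segGraph x _) ⟨i, by omega⟩ ⟨j, by omega⟩
    (by simpa [segGraph, hij] using Or.inl h)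
  simpa only [onlineColoring_segGraph] using this

/-- A position of the game: `n` segments have been presented, and only the lines numbered
below `b` are in use. -/
structure Position where
  n : ℕ
  b : ℕ
  x : ℕ → Seg

/-- The number of segments of `s` on line `l` containing `t`. -/
noncomputable def depth (s : Position) (l : ℕ) (t : ℝ) : ℕ :=
  {j ∈ Finset.range s.n | (s.x j).line = l ∧ (s.x j).lo ≤ t ∧ t ≤ (s.x j).hi}.card

/-- The set of colors used on line `l`. -/
def lineColors (A : OnlineAlg) (s : Position) (l : ℕ) : Finset ℕ :=
  {j ∈ Finset.range s.n | (s.x j).line = l}.image (color A s.x)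

/-- The set of colors used so far. -/
def palette (A : OnlineAlg) (s : Position) : Finset ℕ := (Finset.range s.n).image (color A s.x)

/-- The position respects the length bound `L` and the clique bound `ω`. -/
structure Valid (L : ℝ) (ω : ℕ) (s : Position) : Prop where
  line_lt : ∀ j < s.n, (s.x j).line < s.b
  len : ∀ j < s.n, 1 ≤ (s.x j).hi - (s.x j).lo ∧ (s.x j).hi - (s.x j).lo ≤ L
  depth_le : ∀ l t, depth s l t ≤ ω

/-- `t` continues `s`, presenting new segments only on new lines. -/
structure Extends (s t : Position) : Prop where
  n_le : s.n ≤ t.n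
  b_le : s.b ≤ t.b
  eq : ∀ j < s.n, t.x j = s.x j
  le_line : ∀ j, s.n ≤ j → j < t.n → s.b ≤ (t.x j).line

lemma Extends.refl (s : Position) : Extends s s :=
  ⟨le_rfl, le_rfl, fun _ _ => rfl, fun _ h h' => absurd h' (by omega)⟩

lemma Extends.trans {s t u : Position} (h : Extends s t) (h' : Extends t u) : Extends s u where
  n_le := h.n_le.trans h'.n_le
  b_le := h.b_le.trans h'.b_le
  eq j hj := (h'.eq j (hj.trans_le h.n_le)).trans (h.eq j hj)
  le_line j hj hj' := by
    rcases lt_or_ge j t.n with h1 | h1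
    · rw [h'.eq j h1]; exact h.le_line j hj h1
    · exact h.b_le.trans (h'.le_line j h1 hj')

lemma Extends.color_eq (A : OnlineAlg) {s t : Position} (h : Extends s t) {j : ℕ} (hj : j < s.n) :
    color A t.x j = color A s.x j :=
  color_congr A fun a ha b hb => by rw [h.eq a (by omega), h.eq b (by omega)]

lemma Extends.lt_n {s t : Position} (h : Extends s t) {l j : ℕ} (hl : l < s.b) (hj : j < t.n)
    (hlj : (t.x j).line = l) : j < s.n := by
  by_contra hc
  have := h.le_line j (by omega) hj
  omega

lemma Extends.depth_eq {s t : Position} (h : Extends s t) {l : ℕ} (hl : l < s.b) (p : ℝ) :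
    depth t l p = depth s l p := by
  unfold depth
  congr 1
  ext j
  simp only [Finset.mem_filter, Finset.mem_range]
  constructor
  · rintro ⟨h1, h2⟩
    have h3 := h.lt_n hl h1 h2.1
    rw [h.eq j h3] at h2
    exact ⟨h3, h2⟩
  · rintro ⟨h1, h2⟩
    rw [h.eq j h1]
    exact ⟨h1.trans_le h.n_le, h2⟩

lemma Extends.palette_subset (A : OnlineAlg) {s t : Position} (h : Extends s t) :
    palette A s ⊆ palette A t := by
  intro c hc
  simp only [palette, Finset.mem_image, Finset.mem_range] at hc ⊢
  obtain ⟨j, hj, rfl⟩ := hc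
  exact ⟨j, hj.trans_le h.n_le, h.color_eq A hj⟩

/-- Present `m` copies of the segment `v`. -/
def addBlock (s : Position) (v : Seg) (m : ℕ) : Position where
  n := s.n + m
  b := s.b
  x j := if j < s.n then s.x j else v

/-- The set of colors of the last `m` segments presented in `addBlock s v m`. -/
def blockColors (A : OnlineAlg) (s : Position) (v : Seg) (m : ℕ) : Finset ℕ :=
  (Finset.Ico s.n (s.n + m)).image (color A (addBlock s v m).x)

lemma addBlock_x_of_lt {s : Position} {v : Seg} {m j : ℕ} (h : j < s.n) :
    (addBlock s v m).x j = s.x j := if_pos h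

lemma addBlock_x_of_ge {s : Position} {v : Seg} {m j : ℕ} (h : s.n ≤ j) :
    (addBlock s v m).x j = v := if_neg (by omega)

lemma color_addBlock (A : OnlineAlg) {s : Position} {v : Seg} {m j : ℕ} (h : j < s.n) :
    color A (addBlock s v m).x j = color A s.x j :=
  color_congr A fun a ha b hb => by
    rw [addBlock_x_of_lt (by omega), addBlock_x_of_lt (by omega)]

lemma depth_addBlock_le (s : Position) (v : Seg) (m l : ℕ) (t : ℝ) :
    depth (addBlock s v m) l t ≤
      depth s l t + if v.line = l ∧ v.lo ≤ t ∧ t ≤ v.hi then m else 0 := by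
  unfold depth
  have hsub : {j ∈ Finset.range (addBlock s v m).n | ((addBlock s v m).x j).line = l ∧
        ((addBlock s v m).x j).lo ≤ t ∧ t ≤ ((addBlock s v m).x j).hi} ⊆
      {j ∈ Finset.range s.n | (s.x j).line = l ∧ (s.x j).lo ≤ t ∧ t ≤ (s.x j).hi} ∪
      (if v.line = l ∧ v.lo ≤ t ∧ t ≤ v.hi then Finset.Ico s.n (s.n + m) else ∅) := by
    intro j hj
    simp only [Finset.mem_filter, Finset.mem_range, Finset.mem_union] at hj ⊢
    obtain ⟨h1, h2⟩ := hj
    rcases lt_or_ge j s.n with h | h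
    · rw [addBlock_x_of_lt h] at h2
      exact Or.inl ⟨h, h2⟩
    · rw [addBlock_x_of_ge h] at h2
      rw [if_pos h2]
      exact Or.inr (Finset.mem_Ico.2 ⟨h, h1⟩)
  refine (Finset.card_le_card hsub).trans ((Finset.card_union_le _ _).trans ?_)
  split_ifs <;> simp

lemma Valid.addBlock {L : ℝ} {ω : ℕ} {s : Position} (hs : Valid L ω s) {v : Seg} {m : ℕ}
    (hb : v.line < s.b) (hlen : 1 ≤ v.hi - v.lo ∧ v.hi - v.lo ≤ L)
    (hd : ∀ t, v.lo ≤ t → t ≤ v.hi → depth s v.line t + m ≤ ω) : Valid L ω (addBlock s v m) where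
  line_lt j _ := by
    rcases lt_or_ge j s.n with h | h
    · rw [addBlock_x_of_lt h]; exact hs.line_lt j h
    · rw [addBlock_x_of_ge h]; exact hb
  len j _ := by
    rcases lt_or_ge j s.n with h | h
    · rw [addBlock_x_of_lt h]; exact hs.len j h
    · rw [addBlock_x_of_ge h]; exact hlen
  depth_le l t := by
    refine (depth_addBlock_le s v m l t).trans ?_
    split_ifs with h
    · obtain ⟨rfl, h1, h2⟩ := h
      exact hd t h1 h2
    · exact hs.depth_le l t

lemma Extends.addBlock {s t : Position} (h : Extends s t) {v : Seg} (m : ℕ)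
    (hv : s.b ≤ v.line) : Extends s (addBlock t v m) where
  n_le := h.n_le.trans (Nat.le_add_right _ _)
  b_le := h.b_le
  eq j hj := by rw [addBlock_x_of_lt (hj.trans_le h.n_le), h.eq j hj]
  le_line j hj _ := by
    rcases lt_or_ge j t.n with h1 | h1
    · rw [addBlock_x_of_lt h1]; exact h.le_line j hj h1
    · rw [addBlock_x_of_ge h1]; exact hv

lemma card_blockColors {A : OnlineAlg} (hA : IsProper A) (s : Position) {v : Seg} (m : ℕ)
    (hv : v.lo ≤ v.hi) : (blockColors A s v m).card = m := by
  unfold blockColors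
  rw [Finset.card_image_of_injOn]
  · simp
  · intro i hi j hj hij
    simp only [Finset.coe_Ico, Set.mem_Ico] at hi hj
    by_contra hne
    refine color_ne hA hne ?_ hij
    rw [addBlock_x_of_ge hi.1, addBlock_x_of_ge hj.1]
    exact ⟨rfl, hv, hv⟩

lemma notMem_blockColors {A : OnlineAlg} (hA : IsProper A) {s : Position} {v : Seg} {m j : ℕ}
    (hj : j < s.n) (h : Meets (s.x j) v) : color A s.x j ∉ blockColors A s v m := by
  unfold blockColors
  simp only [Finset.mem_image, Finset.mem_Ico, not_exists, not_and]
  intro i hi hc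
  refine color_ne hA (i := j) (j := i) (by omega) ?_
    ((color_addBlock A (v := v) (m := m) hj).trans hc.symm)
  rwa [addBlock_x_of_lt hj, addBlock_x_of_ge hi.1]

lemma exists_of_mem_blockColors {A : OnlineAlg} {s : Position} {v : Seg} {m c : ℕ}
    (h : c ∈ blockColors A s v m) :
    ∃ j < (addBlock s v m).n, (addBlock s v m).x j = v ∧ color A (addBlock s v m).x j = c := by
  simp only [blockColors, Finset.mem_image, Finset.mem_Ico] at h
  obtain ⟨j, hj, rfl⟩ := h
  exact ⟨j, hj.2, addBlock_x_of_ge hj.1, rfl⟩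

/-- The segments on line `l` are inside `(0, W)` and at most `m` of them share a point. -/
structure Gadget (s : Position) (l : ℕ) (W : ℝ) (m : ℕ) : Prop where
  mem : ∀ j < s.n, (s.x j).line = l → 0 < (s.x j).lo ∧ (s.x j).hi < W
  depth_le : ∀ t, depth s l t ≤ m

lemma depth_eq_zero {s : Position} {l : ℕ} {t : ℝ}
    (h : ∀ j < s.n, (s.x j).line = l → (s.x j).lo ≤ t → t ≤ (s.x j).hi → False) :
    depth s l t = 0 := by
  unfold depth
  rw [Finset.card_eq_zero, Finset.filter_eq_empty_iff]
  intro j hj hc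
  exact h j (Finset.mem_range.1 hj) hc.1 hc.2.1 hc.2.2

lemma Gadget.depth_eq_zero {s : Position} {l m : ℕ} {W : ℝ} (h : Gadget s l W m) {t : ℝ}
    (ht : t ≤ 0 ∨ W ≤ t) : depth s l t = 0 :=
  OnlineInterval.depth_eq_zero fun j hj hl h1 h2 => by
    have := h.mem j hj hl
    rcases ht with ht | ht <;> linarith

lemma Gadget.of_extends {s t : Position} {l m : ℕ} {W : ℝ} (h : Gadget s l W m) (hst : Extends s t)
    (hl : l < s.b) : Gadget t l W m where
  mem j hj hlj := by
    have h1 := hst.lt_n hl hj hlj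
    rw [hst.eq j h1] at hlj ⊢
    exact h.mem j h1 hlj
  depth_le p := by rw [hst.depth_eq hl]; exact h.depth_le p

lemma Extends.lineColors_eq (A : OnlineAlg) {s t : Position} (h : Extends s t) {l : ℕ}
    (hl : l < s.b) : lineColors A t l = lineColors A s l := by
  ext c
  simp only [lineColors, Finset.mem_image, Finset.mem_filter, Finset.mem_range]
  constructor
  · rintro ⟨j, ⟨h1, h2⟩, rfl⟩
    have h3 := h.lt_n hl h1 h2
    rw [h.eq j h3] at h2
    exact ⟨j, ⟨h3, h2⟩, (h.color_eq A h3).symm⟩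
  · rintro ⟨j, ⟨h1, h2⟩, rfl⟩
    exact ⟨j, ⟨h1.trans_le h.n_le, by rw [h.eq j h1, h2]⟩, h.color_eq A h1⟩

/-- The segments on line `l` are those of a gadget with color set `C`, together with `m` copies
of `[0, W]` with color set `D`. -/
structure CoveredGadget (A : OnlineAlg) (s : Position) (l : ℕ) (W : ℝ) (m : ℕ)
    (C D : Finset ℕ) : Prop where
  mem : ∀ j < s.n, (s.x j).line = l → 0 ≤ (s.x j).lo ∧ (s.x j).hi ≤ W
  depth_le : ∀ t, depth s l t ≤ 2 * m
  depth_le_of_boundary : ∀ t, t = 0 ∨ t = W → depth s l t ≤ m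
  inner : ∀ c ∈ C, ∃ j < s.n, (s.x j).line = l ∧ color A s.x j = c
  cover : ∀ d ∈ D, ∃ j < s.n, s.x j = ⟨l, 0, W⟩ ∧ color A s.x j = d

lemma CoveredGadget.depth_eq_zero {A : OnlineAlg} {s : Position} {l m : ℕ} {W : ℝ}
    {C D : Finset ℕ} (h : CoveredGadget A s l W m C D) {t : ℝ}
    (ht : t < 0 ∨ W < t) : depth s l t = 0 :=
  OnlineInterval.depth_eq_zero fun j hj hl h1 h2 => by
    have := h.mem j hj hl
    rcases ht with ht | ht <;> linarith

lemma CoveredGadget.of_extends {A : OnlineAlg} {s t : Position} {l m : ℕ} {W : ℝ} {C D : Finset ℕ}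
    (h : CoveredGadget A s l W m C D) (hst : Extends s t) (hl : l < s.b) :
    CoveredGadget A t l W m C D where
  mem j hj hlj := by
    have h1 := hst.lt_n hl hj hlj
    rw [hst.eq j h1] at hlj ⊢
    exact h.mem j h1 hlj
  depth_le p := by rw [hst.depth_eq hl]; exact h.depth_le p
  depth_le_of_boundary p := by rw [hst.depth_eq hl]; exact h.depth_le_of_boundary p
  inner c hc := by
    obtain ⟨j, hj, h1, h2⟩ := h.inner c hc
    exact ⟨j, hj.trans_le hst.n_le, by rw [hst.eq j hj, h1], by rw [hst.color_eq A hj, h2]⟩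
  cover d hd := by
    obtain ⟨j, hj, h1, h2⟩ := h.cover d hd
    exact ⟨j, hj.trans_le hst.n_le, by rw [hst.eq j hj, h1], by rw [hst.color_eq A hj, h2]⟩

lemma exists_of_mem_lineColors {A : OnlineAlg} {s : Position} {l c : ℕ}
    (h : c ∈ lineColors A s l) : ∃ j < s.n, (s.x j).line = l ∧ color A s.x j = c := by
  simp only [lineColors, Finset.mem_image, Finset.mem_filter, Finset.mem_range] at h
  obtain ⟨j, ⟨h1, h2⟩, h3⟩ := h
  exact ⟨j, h1, h2, h3⟩

lemma Gadget.covered (A : OnlineAlg) {s : Position} {l m : ℕ} {W : ℝ}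
    (h : Gadget s l W m) :
    CoveredGadget A (addBlock s ⟨l, 0, W⟩ m) l W m (lineColors A s l)
      (blockColors A s ⟨l, 0, W⟩ m) where
  mem j _ hl := by
    rcases lt_or_ge j s.n with h1 | h1
    · rw [addBlock_x_of_lt h1] at hl ⊢
      exact ⟨(h.mem j h1 hl).1.le, (h.mem j h1 hl).2.le⟩
    · rw [addBlock_x_of_ge h1]
      exact ⟨le_rfl, le_rfl⟩
  depth_le t := by
    refine (depth_addBlock_le _ _ _ _ _).trans ?_
    have := h.depth_le t
    split_ifs <;> omega
  depth_le_of_boundary t ht := by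
    refine (depth_addBlock_le _ _ _ _ _).trans ?_
    rw [h.depth_eq_zero (ht.imp le_of_eq ge_of_eq)]
    split_ifs <;> omega
  inner c hc := by
    obtain ⟨j, hj, h1, h2⟩ := exists_of_mem_lineColors hc
    exact ⟨j, hj.trans_le (Nat.le_add_right _ _), by rw [addBlock_x_of_lt hj, h1],
      by rw [color_addBlock A hj, h2]⟩
  cover d hd := exists_of_mem_blockColors hd

/-- Place the segments of the lines `l₁`, `l₂`, `l₃`, `l₄` side by side on the line `l`, the parts
having width `W`. -/
noncomputable def regroup (W : ℝ) (l₁ l₂ l₃ l₄ l : ℕ) (v : Seg) : Seg :=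
  if v.line = l₁ then ⟨l, v.lo + 1, v.hi + 1⟩
  else if v.line = l₂ then ⟨l, v.lo + (1 + W), v.hi + (1 + W)⟩
  else if v.line = l₃ then ⟨l, v.lo + (1 + 2 * W), v.hi + (1 + 2 * W)⟩
  else if v.line = l₄ then ⟨l, v.lo + (1 + 3 * W), v.hi + (1 + 3 * W)⟩
  else v

/-- Segments that `regroup` moves to disjoint parts of the common line. -/
structure Regroupable (W : ℝ) (l₁ l₂ l₃ l₄ l : ℕ) (v : Seg) : Prop where
  line_lt : v.line < l
  lo_le_hi : v.lo ≤ v.hi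
  mem₁ : v.line = l₁ → 0 ≤ v.lo ∧ v.hi ≤ W
  mem₂ : v.line = l₂ → 0 < v.lo ∧ v.hi < W
  mem₃ : v.line = l₃ → 0 < v.lo ∧ v.hi < W
  mem₄ : v.line = l₄ → 0 ≤ v.lo ∧ v.hi ≤ W

lemma meets_regroup {W : ℝ} (hW : 0 < W) {l₁ l₂ l₃ l₄ l : ℕ} {v w : Seg}
    (hv : Regroupable W l₁ l₂ l₃ l₄ l v) (hw : Regroupable W l₁ l₂ l₃ l₄ l w) :
    Meets (regroup W l₁ l₂ l₃ l₄ l v) (regroup W l₁ l₂ l₃ l₄ l w) ↔ Meets v w := by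
  obtain ⟨a, b, c⟩ := v
  obtain ⟨a', b', c'⟩ := w
  obtain ⟨h1, h2, h3, h4, h5, h6⟩ := hv
  obtain ⟨g1, g2, g3, g4, g5, g6⟩ := hw
  simp only at *
  unfold regroup Meets
  split_ifs <;> simp only <;> grind

lemma depth_regroup_le (s : Position) (W : ℝ) (l₁ l₂ l₃ l₄ l : ℕ)
    (hlt : ∀ j < s.n, (s.x j).line < l) (t : ℝ) :
    depth ⟨s.n, l + 1, fun j => regroup W l₁ l₂ l₃ l₄ l (s.x j)⟩ l t ≤
      depth s l₁ (t - 1) + depth s l₂ (t - (1 + W)) + depth s l₃ (t - (1 + 2 * W)) +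
        depth s l₄ (t - (1 + 3 * W)) := by
  unfold depth
  refine le_trans (Finset.card_le_card ?_) ((Finset.card_union_le _ _).trans
    (Nat.add_le_add_right ((Finset.card_union_le _ _).trans
    (Nat.add_le_add_right (Finset.card_union_le _ _) _)) _))
  intro j hj
  simp only [Finset.mem_filter, Finset.mem_range, Finset.mem_union] at hj ⊢
  have h1 := hlt j hj.1
  unfold regroup at hj
  split_ifs at hj <;> grind

lemma depth_regroup_le_of_ne (s : Position) (W : ℝ) (l₁ l₂ l₃ l₄ l : ℕ) {k : ℕ} (hk : k ≠ l)
    (t : ℝ) :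
    depth ⟨s.n, l + 1, fun j => regroup W l₁ l₂ l₃ l₄ l (s.x j)⟩ k t ≤ depth s k t := by
  unfold depth
  refine Finset.card_le_card ?_
  intro j hj
  simp only [Finset.mem_filter, Finset.mem_range] at hj ⊢
  unfold regroup at hj
  split_ifs at hj <;> grind

lemma exists_stable {α β : Type*} (r : α → α → Prop) (R : α → β → Prop)
    (htrans : ∀ s t u, r s t → r t u → r s u) (hanti : ∀ s t o, r s t → R t o → R s o)
    (O : Finset β) (s : α) (hs : r s s) (h : ∀ t, r s t → ∃ o ∈ O, R t o) :
    ∃ s₁, r s s₁ ∧ ∃ o, ∀ t, r s₁ t → R t o := by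
  classical
  by_contra! hc
  have key : ∀ O' : Finset β, ∃ t, r s t ∧ ∀ o ∈ O', ¬ R t o := by
    intro O'
    induction O' using Finset.induction_on with
    | empty => exact ⟨s, hs, by simp⟩
    | insert o O' _ ih =>
      obtain ⟨t, ht, ht'⟩ := ih
      obtain ⟨u, hu, hu'⟩ := hc t ht o
      refine ⟨u, htrans _ _ _ ht hu, fun o' ho' => ?_⟩
      rcases Finset.mem_insert.1 ho' with rfl | ho'
      · exact hu'
      · exact fun hR => ht' o' ho' (hanti _ _ _ hu hR)
  obtain ⟨t, ht, ht'⟩ := key O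
  obtain ⟨o, ho, hR⟩ := h t ht
  exact ht' o ho hR

/-- Two covered gadgets and two uncovered ones with the same color sets `C` and `D` combine into
a gadget with `3 * m` colors besides those in `C`. -/
lemma exists_gadget_of_four {A : OnlineAlg} (hA : IsProper A) {L W : ℝ} {ω m : ℕ} (hW : 1 ≤ W)
    (hWL : W ≤ L) (hm : 2 * m ≤ ω) {r s : Position} (hr : Valid L ω r) (hs : Valid L ω s)
    (hrs : Extends r s) {l₁ l₂ l₃ l₄ : ℕ} (h₁₂ : l₁ ≠ l₂) (h₁₃ : l₁ ≠ l₃) (h₁₄ : l₁ ≠ l₄)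
    (h₂₃ : l₂ ≠ l₃) (h₂₄ : l₂ ≠ l₄) (h₃₄ : l₃ ≠ l₄) (hl₁ : r.b ≤ l₁) (hl₂ : r.b ≤ l₂)
    (hl₃ : r.b ≤ l₃) (hl₄ : r.b ≤ l₄) {C D : Finset ℕ} (hD : D.card = m) (hCD : Disjoint C D)
    (hg₁ : CoveredGadget A s l₁ W m C D) (hg₂ : Gadget s l₂ W m) (hC₂ : lineColors A s l₂ = C)
    (hg₃ : Gadget s l₃ W m) (hC₃ : lineColors A s l₃ = C) (hg₄ : CoveredGadget A s l₄ W m C D) :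
    ∃ t l, Extends r t ∧ Valid L ω t ∧ r.b ≤ l ∧ l < t.b ∧ Gadget t l (4 * W + 3) (2 * m) ∧
      C.card + 3 * m ≤ (lineColors A t l).card := by
  set g := regroup W l₁ l₂ l₃ l₄ s.b with hgdef
  have hre : ∀ j < s.n, Regroupable W l₁ l₂ l₃ l₄ s.b (s.x j) := fun j hj =>
    ⟨hs.line_lt j hj, by linarith [(hs.len j hj).1], hg₁.mem j hj, hg₂.mem j hj, hg₃.mem j hj,
      hg₄.mem j hj⟩
  set M : Position := ⟨s.n, s.b + 1, fun j => g (s.x j)⟩ with hM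
  have hcolor : ∀ j < s.n, color A M.x j = color A s.x j := fun j hj =>
    color_congr A fun a ha b hb =>
      meets_regroup (by linarith) (hre a (by omega)) (hre b (by omega))
  have hx₁ : ∀ j, (s.x j).line = l₁ → M.x j = ⟨s.b, (s.x j).lo + 1, (s.x j).hi + 1⟩ := by
    intro j h
    simp [hM, hgdef, regroup, h]
  have hx₂ : ∀ j, (s.x j).line = l₂ →
      M.x j = ⟨s.b, (s.x j).lo + (1 + W), (s.x j).hi + (1 + W)⟩ := by
    intro j h
    simp [hM, hgdef, regroup, h, h₁₂.symm]
  have hx₃ : ∀ j, (s.x j).line = l₃ →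
      M.x j = ⟨s.b, (s.x j).lo + (1 + 2 * W), (s.x j).hi + (1 + 2 * W)⟩ := by
    intro j h
    simp [hM, hgdef, regroup, h, h₁₃.symm, h₂₃.symm]
  have hx₄ : ∀ j, (s.x j).line = l₄ →
      M.x j = ⟨s.b, (s.x j).lo + (1 + 3 * W), (s.x j).hi + (1 + 3 * W)⟩ := by
    intro j h
    simp [hM, hgdef, regroup, h, h₁₄.symm, h₂₄.symm, h₃₄.symm]
  have hx : ∀ v : Seg, (g v).line = v.line ∨ (g v).line = s.b ∧ r.b ≤ v.line := by
    intro v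
    rw [hgdef]
    unfold regroup
    split_ifs <;> grind
  have hlen : ∀ v : Seg, (g v).hi - (g v).lo = v.hi - v.lo := by
    intro v
    rw [hgdef]
    unfold regroup
    split_ifs <;> simp
  have hinside : ∀ j < s.n, (M.x j).line = s.b → 0 < (M.x j).lo ∧ (M.x j).hi < 4 * W + 3 := by
    intro j hj h
    have h1 := hre j hj
    have h2 := h1.line_lt
    have h3 := h1.mem₁
    have h4 := h1.mem₂
    have h5 := h1.mem₃
    have h6 := h1.mem₄
    simp only [hM, hgdef] at h ⊢
    unfold regroup at h ⊢
    split_ifs at h ⊢ <;> grind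
  have hdepth : ∀ t, depth M s.b t ≤ depth s l₁ (t - 1) + depth s l₂ (t - (1 + W)) +
      depth s l₃ (t - (1 + 2 * W)) + depth s l₄ (t - (1 + 3 * W)) :=
    depth_regroup_le s W l₁ l₂ l₃ l₄ s.b hs.line_lt
  have hdepth_le : ∀ t, depth M s.b t ≤ 2 * m ∧
      (1 + W ≤ t → t ≤ 1 + 3 * W → depth M s.b t ≤ m) ∧
      (t = 1 + 2 * W → depth M s.b t = 0) := by
    intro t
    have a1 := hg₁.depth_le (t - 1)
    have a2 := hg₂.depth_le (t - (1 + W))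
    have a3 := hg₃.depth_le (t - (1 + 2 * W))
    have a4 := hg₄.depth_le (t - (1 + 3 * W))
    have b1 := fun h => hg₁.depth_le_of_boundary (t - 1) h
    have b4 := fun h => hg₄.depth_le_of_boundary (t - (1 + 3 * W)) h
    have z1 := fun h => hg₁.depth_eq_zero (t := t - 1) h
    have z2 := fun h => hg₂.depth_eq_zero (t := t - (1 + W)) h
    have z3 := fun h => hg₃.depth_eq_zero (t := t - (1 + 2 * W)) h
    have z4 := fun h => hg₄.depth_eq_zero (t := t - (1 + 3 * W)) h
    have hd := hdepth t
    rcases le_or_gt t (1 + W) with c1 | c1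
    · have := z2 (Or.inl (by linarith))
      have := z3 (Or.inl (by linarith))
      have := z4 (Or.inl (by linarith))
      refine ⟨by omega, fun h _ => ?_, fun h => by linarith⟩
      have := b1 (Or.inr (by linarith))
      omega
    have := z1 (Or.inr (by linarith))
    rcases le_or_gt t (1 + 2 * W) with c2 | c2
    · have := z3 (Or.inl (by linarith))
      have := z4 (Or.inl (by linarith))
      refine ⟨by omega, fun _ _ => by omega, fun h => ?_⟩
      have := z2 (Or.inr (by linarith))
      omega
    have := z2 (Or.inr (by linarith))
    rcases lt_or_ge t (1 + 3 * W) with c3 | c3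
    · have := z4 (Or.inl (by linarith))
      exact ⟨by omega, fun _ _ => by omega, fun h => by linarith⟩
    have := z3 (Or.inr (by linarith))
    refine ⟨by omega, fun _ h => ?_, fun h => by linarith⟩
    have := b4 (Or.inl (by linarith))
    omega
  have hMvalid : Valid L ω M := by
    refine ⟨fun j hj => ?_, fun j hj => ?_, fun l t => ?_⟩
    · have h1 := hs.line_lt j hj
      have h2 := hx (s.x j)
      change (g (s.x j)).line < s.b + 1
      omega
    · change 1 ≤ (g (s.x j)).hi - (g (s.x j)).lo ∧ (g (s.x j)).hi - (g (s.x j)).lo ≤ L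
      rw [hlen]
      exact hs.len j hj
    · rcases eq_or_ne l s.b with rfl | h
      · exact (hdepth_le t).1.trans hm
      · exact (depth_regroup_le_of_ne s W l₁ l₂ l₃ l₄ s.b h t).trans (hs.depth_le l t)
  have hMext : Extends r M := by
    refine ⟨hrs.n_le, hrs.b_le.trans (Nat.le_succ _), fun j hj => ?_, fun j hj hj' => ?_⟩
    · have h1 := hr.line_lt j hj
      change g (s.x j) = r.x j
      rw [hrs.eq j hj, hgdef]
      unfold regroup
      rw [if_neg (by omega), if_neg (by omega), if_neg (by omega), if_neg (by omega)]
    · have h1 := hrs.le_line j hj hj'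
      have h2 := hx (s.x j)
      have h3 := hrs.b_le
      change r.b ≤ (g (s.x j)).line
      omega
  set P : Seg := ⟨s.b, 1 + W, 1 + 2 * W⟩ with hP
  set Q : Seg := ⟨s.b, 1 + 2 * W, 1 + 3 * W⟩ with hQ
  set M₁ := addBlock M P m with hM₁
  set T := addBlock M₁ Q m with hT
  have hd₁ : ∀ t, depth M₁ s.b t ≤ 2 * m ∧
      (1 + 2 * W ≤ t → t ≤ 1 + 3 * W → depth M₁ s.b t ≤ m) := by
    intro t
    have h1 := depth_addBlock_le M P m s.b t
    obtain ⟨h2, h3, h4⟩ := hdepth_le t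
    rw [← hM₁] at h1
    by_cases h : P.line = s.b ∧ P.lo ≤ t ∧ t ≤ P.hi
    · rw [if_pos h] at h1
      simp only [hP] at h
      have := h3 (by linarith) (by linarith)
      refine ⟨by omega, fun h5 _ => ?_⟩
      have := h4 (by linarith)
      omega
    · rw [if_neg h] at h1
      refine ⟨by omega, fun h5 h6 => ?_⟩
      have := h3 (by linarith) (by linarith)
      omega
  have hd₂ : ∀ t, depth T s.b t ≤ 2 * m := by
    intro t
    have h1 := depth_addBlock_le M₁ Q m s.b t
    rw [← hT] at h1
    obtain ⟨h2, h3⟩ := hd₁ t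
    by_cases h : Q.line = s.b ∧ Q.lo ≤ t ∧ t ≤ Q.hi
    · rw [if_pos h] at h1
      have := h3 h.2.1 h.2.2
      omega
    · rw [if_neg h] at h1
      omega
  have hM₁valid : Valid L ω M₁ := by
    refine hMvalid.addBlock (Nat.lt_succ_self _) ⟨by simp only [hP]; linarith,
      by simp only [hP]; linarith⟩ fun t h1 h2 => ?_
    simp only [hP] at h1 h2
    have := (hdepth_le t).2.1 h1 (by linarith)
    change depth M s.b t + m ≤ ω
    omega
  have hTvalid : Valid L ω T := by
    refine hM₁valid.addBlock (Nat.lt_succ_self _) ⟨by simp only [hQ]; linarith,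
      by simp only [hQ]; linarith⟩ fun t h1 h2 => ?_
    have := (hd₁ t).2 h1 h2
    change depth M₁ s.b t + m ≤ ω
    omega
  have hText : Extends r T := (hMext.addBlock m hrs.b_le).addBlock m hrs.b_le
  have hTmem : ∀ j < T.n, (T.x j).line = s.b → 0 < (T.x j).lo ∧ (T.x j).hi < 4 * W + 3 := by
    intro j _ h
    rcases lt_or_ge j M₁.n with h1 | h1
    · rw [hT, addBlock_x_of_lt h1] at h ⊢
      rcases lt_or_ge j M.n with h2 | h2
      · rw [hM₁, addBlock_x_of_lt h2] at h ⊢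
        exact hinside j h2 h
      · rw [hM₁, addBlock_x_of_ge h2]
        simp only [hP]
        constructor <;> linarith
    · rw [hT, addBlock_x_of_ge h1]
      simp only [hQ]
      constructor <;> linarith
  have hM₁n : M.n ≤ M₁.n := Nat.le_add_right _ _
  have hTn : M₁.n ≤ T.n := Nat.le_add_right _ _
  have hM₁x : ∀ j < M.n, M₁.x j = M.x j ∧ color A M₁.x j = color A M.x j := fun j hj =>
    ⟨addBlock_x_of_lt hj, color_addBlock A hj⟩
  have hTx : ∀ j < M₁.n, T.x j = M₁.x j ∧ color A T.x j = color A M₁.x j := fun j hj =>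
    ⟨addBlock_x_of_lt hj, color_addBlock A hj⟩
  set p := blockColors A M P m with hp
  set q := blockColors A M₁ Q m with hq
  have hpcard : p.card = m := card_blockColors hA M m (by simp only [hP]; linarith)
  have hqcard : q.card = m := card_blockColors hA M₁ m (by simp only [hQ]; linarith)
  have hCp : Disjoint (C ∪ D) p := by
    rw [Finset.disjoint_left]
    intro c hc
    obtain ⟨j, hj, hmeets, rfl⟩ : ∃ j < s.n, Meets (M.x j) P ∧ color A s.x j = c := by
      rcases Finset.mem_union.1 hc with hc | hc
      · obtain ⟨j, hj, h1, h2⟩ := exists_of_mem_lineColors (hC₂ ▸ hc)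
        refine ⟨j, hj, ?_, h2⟩
        have := (hre j hj).lo_le_hi
        have := hg₂.mem j hj h1
        rw [hx₂ j h1]
        exact ⟨rfl, by simp only [hP]; linarith, by simp only [hP]; linarith⟩
      · obtain ⟨j, hj, h1, h2⟩ := hg₁.cover c hc
        refine ⟨j, hj, ?_, h2⟩
        rw [hx₁ j (by rw [h1]), h1]
        exact ⟨rfl, by simp only [hP]; linarith, by simp only [hP]; linarith⟩
    rw [← hcolor j hj]
    exact notMem_blockColors hA hj hmeets
  have hCq : Disjoint (C ∪ D ∪ p) q := by
    rw [Finset.disjoint_left]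
    intro c hc
    obtain ⟨j, hj, hmeets, rfl⟩ : ∃ j < M₁.n, Meets (M₁.x j) Q ∧ color A M₁.x j = c := by
      rcases Finset.mem_union.1 hc with hc | hc
      · obtain ⟨j, hj, hmeets, rfl⟩ : ∃ j < s.n, Meets (M.x j) Q ∧ color A s.x j = c := by
          rcases Finset.mem_union.1 hc with hc | hc
          · obtain ⟨j, hj, h1, h2⟩ := exists_of_mem_lineColors (hC₃ ▸ hc)
            refine ⟨j, hj, ?_, h2⟩
            have := (hre j hj).lo_le_hi
            have := hg₃.mem j hj h1
            rw [hx₃ j h1]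
            exact ⟨rfl, by simp only [hQ]; linarith, by simp only [hQ]; linarith⟩
          · obtain ⟨j, hj, h1, h2⟩ := hg₄.cover c hc
            refine ⟨j, hj, ?_, h2⟩
            rw [hx₄ j (by rw [h1]), h1]
            exact ⟨rfl, by simp only [hQ]; linarith, by simp only [hQ]; linarith⟩
        refine ⟨j, lt_of_lt_of_le hj hM₁n, ?_, ?_⟩
        · rwa [(hM₁x j hj).1]
        · rw [(hM₁x j hj).2, hcolor j hj]
      · obtain ⟨j, hj, h1, h2⟩ := exists_of_mem_blockColors hc
        refine ⟨j, hj, ?_, h2⟩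
        rw [h1]
        exact ⟨rfl, by simp only [hP, hQ]; linarith, by simp only [hP, hQ]; linarith⟩
    exact notMem_blockColors hA hj hmeets
  have hsub : C ∪ D ∪ p ∪ q ⊆ lineColors A T s.b := by
    intro c hc
    simp only [lineColors, Finset.mem_image, Finset.mem_filter, Finset.mem_range]
    rcases Finset.mem_union.1 hc with hc | hc
    · obtain ⟨j, hj, hline, rfl⟩ : ∃ j < M₁.n, (M₁.x j).line = s.b ∧ color A M₁.x j = c := by
        rcases Finset.mem_union.1 hc with hc | hc
        · obtain ⟨j, hj, hline, rfl⟩ : ∃ j < s.n, (s.x j).line = l₁ ∧ color A s.x j = c := by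
            rcases Finset.mem_union.1 hc with hc | hc
            · exact hg₁.inner c hc
            · obtain ⟨j, hj, h1, h2⟩ := hg₁.cover c hc
              exact ⟨j, hj, by rw [h1], h2⟩
          refine ⟨j, lt_of_lt_of_le hj hM₁n, ?_, ?_⟩
          · rw [(hM₁x j hj).1, hx₁ j hline]
          · rw [(hM₁x j hj).2, hcolor j hj]
        · obtain ⟨j, hj, h1, h2⟩ := exists_of_mem_blockColors hc
          exact ⟨j, hj, by rw [h1], h2⟩
      exact ⟨j, ⟨hj.trans_le hTn, by rw [(hTx j hj).1, hline]⟩, (hTx j hj).2⟩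
    · obtain ⟨j, hj, h1, h2⟩ := exists_of_mem_blockColors hc
      exact ⟨j, ⟨hj, by rw [h1]⟩, h2⟩
  refine ⟨T, s.b, hText, hTvalid, hrs.b_le, Nat.lt_succ_self _, ⟨hTmem, hd₂⟩, ?_⟩
  have hcard := Finset.card_le_card hsub
  rw [Finset.card_union_of_disjoint hCq, Finset.card_union_of_disjoint hCp,
    Finset.card_union_of_disjoint hCD, hD, hpcard, hqcard] at hcard
  omega

/-- From every valid position extending `s₀` one can reach, on a new line, a gadget of width `W`
and clique number at most `m` which has at least `c` colors. -/
def Forces (A : OnlineAlg) (L : ℝ) (ω : ℕ) (s₀ : Position) (W : ℝ) (m c : ℕ) : Prop :=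
  ∀ s, Extends s₀ s → Valid L ω s → ∃ t l, Extends s t ∧ Valid L ω t ∧ s.b ≤ l ∧ l < t.b ∧
    Gadget t l W m ∧ c ≤ (lineColors A t l).card

lemma lineColors_subset_palette (A : OnlineAlg) (s : Position) (l : ℕ) :
    lineColors A s l ⊆ palette A s :=
  Finset.image_subset_image (Finset.filter_subset _ _)

lemma blockColors_subset_palette (A : OnlineAlg) (s : Position) (v : Seg) (m : ℕ) :
    blockColors A s v m ⊆ palette A (addBlock s v m) := by
  refine Finset.image_subset_image fun j hj => ?_
  exact Finset.mem_range.2 (Finset.mem_Ico.1 hj).2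

lemma Gadget.valid_addBlock {L W : ℝ} {ω m l : ℕ} {s : Position} (h : Gadget s l W m)
    (hs : Valid L ω s) (hl : l < s.b) (hW : 1 ≤ W) (hWL : W ≤ L) (hm : 2 * m ≤ ω) :
    Valid L ω (addBlock s ⟨l, 0, W⟩ m) := by
  refine hs.addBlock hl ⟨by simpa using hW, by simpa using hWL⟩ fun t _ _ => ?_
  have := h.depth_le t
  change depth s l t + m ≤ ω
  omega

lemma Gadget.disjoint_blockColors {A : OnlineAlg} (hA : IsProper A) {L W : ℝ} {ω m l : ℕ}
    {s : Position} (h : Gadget s l W m) (hs : Valid L ω s) :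
    Disjoint (lineColors A s l) (blockColors A s ⟨l, 0, W⟩ m) := by
  rw [Finset.disjoint_left]
  intro c hc
  obtain ⟨j, hj, h1, rfl⟩ := exists_of_mem_lineColors hc
  have h2 := h.mem j hj h1
  have h3 := (hs.len j hj).1
  exact notMem_blockColors hA hj ⟨h1, by simp only; linarith, by simp only; linarith⟩

lemma Forces.step {A : OnlineAlg} (hA : IsProper A) {L W : ℝ} {ω m c : ℕ} {s₀ : Position}
    {K : Finset ℕ} (hK : ∀ s, Extends s₀ s → Valid L ω s → palette A s ⊆ K)
    (hW : 1 ≤ W) (hWL : W ≤ L) (hm : 2 * m ≤ ω) (hF : Forces A L ω s₀ W m c) :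
    Forces A L ω s₀ (4 * W + 3) (2 * m) (c + 3 * m) := by
  intro s hs hsv
  let R : Position → Finset ℕ × Finset ℕ → Prop := fun s o =>
    ∃ t l, Extends s t ∧ Valid L ω t ∧ s.b ≤ l ∧ l < t.b ∧ Gadget t l W m ∧
      c ≤ (lineColors A t l).card ∧ lineColors A t l = o.1 ∧ blockColors A t ⟨l, 0, W⟩ m = o.2
  obtain ⟨s₁, ⟨hs₁, hs₁v⟩, ⟨C, D⟩, hstable⟩ :=
    exists_stable (fun s t => Extends s t ∧ Valid L ω t) R
      (fun _ _ _ h h' => ⟨h.1.trans h'.1, h'.2⟩)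
      (fun s t o h ⟨u, l, h1, h2, h3, h4⟩ => ⟨u, l, h.1.trans h1, h2, h.1.b_le.trans h3, h4⟩)
      (K.powerset ×ˢ K.powerset) s ⟨Extends.refl s, hsv⟩ (by
        rintro t ⟨ht, htv⟩
        obtain ⟨u, l, h1, h2, h3, h4, h5, h6⟩ := hF t (hs.trans ht) htv
        have hu := (hs.trans ht).trans h1
        refine ⟨(lineColors A u l, blockColors A u ⟨l, 0, W⟩ m), ?_, u, l, h1, h2, h3, h4, h5, h6,
          rfl, rfl⟩
        simp only [Finset.mem_product, Finset.mem_powerset]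
        exact ⟨(lineColors_subset_palette A u l).trans (hK u hu h2),
          (blockColors_subset_palette A u _ m).trans (hK _
            (hu.addBlock m ((hs.trans ht).b_le.trans h3))
            (h5.valid_addBlock h2 h4 hW hWL hm))⟩)
  obtain ⟨t₁, l₁, e₁, v₁, b₁, b₁', g₁, hc, rfl, rfl⟩ := hstable s₁ ⟨Extends.refl s₁, hs₁v⟩
  set C := lineColors A t₁ l₁ with hC
  set D := blockColors A t₁ ⟨l₁, 0, W⟩ m with hD
  have hCD : Disjoint C D := g₁.disjoint_blockColors hA v₁
  have hDcard : D.card = m := card_blockColors hA t₁ m (by simp only; linarith)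
  have k₁ := g₁.covered A
  have w₁ := g₁.valid_addBlock v₁ b₁' hW hWL hm
  have f₁ : Extends s₁ (addBlock t₁ ⟨l₁, 0, W⟩ m) := e₁.addBlock m b₁
  rw [← hC, ← hD] at k₁
  have b₁'' : l₁ < (addBlock t₁ ⟨l₁, 0, W⟩ m).b := b₁'
  generalize addBlock t₁ ⟨l₁, 0, W⟩ m = u₁ at k₁ w₁ f₁ b₁''
  obtain ⟨t₂, l₂, e₂, v₂, b₂, b₂', g₂, -, hC₂, hD₂⟩ := hstable u₁ ⟨f₁, w₁⟩
  have k₂ := g₂.covered A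
  have w₂ := g₂.valid_addBlock v₂ b₂' hW hWL hm
  have f₂ : Extends u₁ (addBlock t₂ ⟨l₂, 0, W⟩ m) := e₂.addBlock m b₂
  rw [hC₂, hD₂] at k₂
  have b₂'' : l₂ < (addBlock t₂ ⟨l₂, 0, W⟩ m).b := b₂'
  generalize addBlock t₂ ⟨l₂, 0, W⟩ m = u₂ at k₂ w₂ f₂ b₂''
  obtain ⟨t₃, l₃, e₃, v₃, b₃, b₃', g₃, -, hC₃, -⟩ := hstable u₂ ⟨f₁.trans f₂, w₂⟩
  obtain ⟨t₄, l₄, e₄, v₄, b₄, b₄', g₄, -, hC₄, -⟩ := hstable t₃ ⟨(f₁.trans f₂).trans e₃, v₃⟩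
  have i₀ := hs₁.b_le
  have i₁ := f₁.b_le
  have i₂ := f₂.b_le
  have i₃ := e₃.b_le
  obtain ⟨T, l, h1, h2, h3, h4, h5, h6⟩ := exists_gadget_of_four hA hW hWL hm hsv v₄
    (hs₁.trans (((f₁.trans f₂).trans e₃).trans e₄)) (l₁ := l₁) (l₂ := l₃) (l₃ := l₄) (l₄ := l₂)
    (by omega) (by omega) (by omega) (by omega) (by omega) (by omega) (by omega) (by omega)
    (by omega) (by omega) hDcard hCD (k₁.of_extends ((f₂.trans e₃).trans e₄) b₁'')
    (g₃.of_extends e₄ b₃') ((e₄.lineColors_eq A b₃').trans hC₃) g₄ hC₄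
    (k₂.of_extends (e₃.trans e₄) b₂'')
  exact ⟨T, l, h1, h2, h3, h4, h5, by omega⟩

lemma forces_zero (A : OnlineAlg) (L : ℝ) (ω : ℕ) (s₀ : Position) (W : ℝ) (m : ℕ) :
    Forces A L ω s₀ W m 0 := by
  intro s _ hs
  have hline : ∀ j < s.n, (s.x j).line ≠ s.b := fun j hj => (hs.line_lt j hj).ne
  refine ⟨⟨s.n, s.b + 1, s.x⟩, s.b, ⟨le_rfl, Nat.le_succ _, fun _ _ => rfl, ?_⟩,
    ⟨fun j hj => (hs.line_lt j hj).trans (Nat.lt_succ_self _), hs.len, hs.depth_le⟩, le_rfl,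
    Nat.lt_succ_self _, ⟨fun j hj h => absurd h (hline j hj), fun t => ?_⟩, Nat.zero_le _⟩
  · exact fun j h h' => absurd h' (by simp only; omega)
  · exact (depth_eq_zero fun j hj h _ _ => hline j hj h).trans_le (Nat.zero_le _)

lemma forces_level {A : OnlineAlg} (hA : IsProper A) {L : ℝ} {ω : ℕ} {s₀ : Position}
    {K : Finset ℕ} (hK : ∀ s, Extends s₀ s → Valid L ω s → palette A s ⊆ K) (r : ℕ) :
    ∀ k, 2 * 4 ^ k ≤ 4 * L → r * 2 ^ k ≤ ω →
      Forces A L ω s₀ (2 * 4 ^ k - 1) (r * 2 ^ k) (3 * r * (2 ^ k - 1))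
  | 0, _, _ => forces_zero A L ω s₀ (2 * 4 ^ 0 - 1) (r * 2 ^ 0)
  | k + 1, hL, hω => by
    have h4 : (1 : ℝ) ≤ 4 ^ k := one_le_pow₀ (by norm_num)
    rw [pow_succ] at hL hω
    have ih := forces_level hA hK r k (by linarith) (by nlinarith)
    have hstep := ih.step hA hK (by linarith) (by linarith) (by linarith)
    convert hstep using 1
    · ring
    · ring
    · have h2 := Nat.one_le_two_pow (n := k)
      obtain ⟨q, hq⟩ := Nat.exists_eq_add_of_le h2
      rw [pow_succ, hq]
      have e1 : (1 + q) * 2 - 1 = 2 * q + 1 := by omega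
      have e2 : 1 + q - 1 = q := by omega
      rw [e1, e2]
      ring

/-- A valid position is realized by intervals in the real line, with the same coloring. -/
lemma Valid.exists_intervals (A : OnlineAlg) {L : ℝ} {ω : ℕ} {s : Position} (hs : Valid L ω s) :
    ∃ x : Fin s.n → ℝ × ℝ,
      (∀ j, 1 ≤ (x j).2 - (x j).1 ∧ (x j).2 - (x j).1 ≤ L) ∧
      (∀ t : ℝ, {j : Fin s.n | t ∈ Set.Icc (x j).1 (x j).2}.ncard ≤ ω) ∧
      (Set.range (onlineColoring A (intervalGraph x))).ncard = (palette A s).card := by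
  obtain ⟨B, hB⟩ : ∃ B : ℝ, ∀ j < s.n, |(s.x j).lo| < B ∧ |(s.x j).hi| < B := by
    refine ⟨∑ j ∈ Finset.range s.n, (|(s.x j).lo| + |(s.x j).hi|) + 1, fun j hj => ?_⟩
    have := Finset.single_le_sum (f := fun j => |(s.x j).lo| + |(s.x j).hi|)
      (fun i _ => by positivity) (Finset.mem_range.2 hj)
    have h1 := abs_nonneg (s.x j).lo
    have h2 := abs_nonneg (s.x j).hi
    constructor <;> linarith
  let x : Fin s.n → ℝ × ℝ := fun j =>
    ((s.x j).lo + (s.x j).line * (2 * B), (s.x j).hi + (s.x j).line * (2 * B))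
  have hmeets : ∀ (i j : Fin s.n) (t : ℝ), t ∈ Set.Icc (x i).1 (x i).2 →
      t ∈ Set.Icc (x j).1 (x j).2 → (s.x i).line = (s.x j).line := by
    intro i j t hi hj
    simp only [x, Set.mem_Icc] at hi hj
    have bi := hB i i.2
    have bj := hB j j.2
    simp only [abs_lt] at bi bj
    have key : ∀ a b : ℕ, a < b → (b : ℝ) * (2 * B) - a * (2 * B) < 2 * B → False := by
      intro a b hab h
      have h1 : (a : ℝ) + 1 ≤ b := by exact_mod_cast hab
      nlinarith
    rcases lt_trichotomy (s.x i).line (s.x j).line with h | h | h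
    · exact (key _ _ h (by linarith)).elim
    · exact h
    · exact (key _ _ h (by linarith)).elim
  have hgraph : intervalGraph x = segGraph s.x s.n := by
    have hrel : ∀ i j : Fin s.n, (Set.Icc (x i).1 (x i).2 ∩ Set.Icc (x j).1 (x j).2).Nonempty ↔
        Meets (s.x i) (s.x j) := by
      intro i j
      constructor
      · rintro ⟨t, hi, hj⟩
        have h := hmeets i j t hi hj
        simp only [x, Set.mem_Icc, h] at hi hj
        exact ⟨h, by linarith, by linarith⟩
      · rintro ⟨h, h1, h2⟩
        have li := (hs.len i i.2).1
        have lj := (hs.len j j.2).1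
        refine ⟨max (x i).1 (x j).1, ⟨le_max_left _ _, max_le ?_ ?_⟩,
          le_max_right _ _, max_le ?_ ?_⟩ <;> simp only [x, h] <;> linarith
    ext i j
    simp only [intervalGraph, segGraph, SimpleGraph.fromRel_adj, hrel]
  refine ⟨x, fun j => ?_, fun t => ?_, ?_⟩
  · have := hs.len j j.2
    simp only [x]
    constructor <;> linarith
  · rcases Set.eq_empty_or_nonempty {j : Fin s.n | t ∈ Set.Icc (x j).1 (x j).2} with h | ⟨i, hi⟩
    · rw [h, Set.ncard_empty]
      exact Nat.zero_le _
    · refine le_trans ?_ (hs.depth_le (s.x i).line (t - (s.x i).line * (2 * B)))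
      unfold depth
      rw [← Set.ncard_coe_finset]
      refine Set.ncard_le_ncard_of_injOn (fun j => (j : ℕ)) (fun j hj => ?_)
        (fun a _ b _ h => Fin.ext h) (Finset.finite_toSet _)
      have h := hmeets i j t hi hj
      simp only [x, Set.mem_ofPred_eq, Set.mem_Icc] at hj
      simp only [Finset.coe_filter, Finset.mem_range, Set.mem_ofPred_eq]
      exact ⟨j.2, h.symm, by rw [h]; linarith, by rw [h]; linarith⟩
  · rw [hgraph, ← Set.ncard_coe_finset]
    congr 1
    ext c
    simp only [Set.mem_range, onlineColoring_segGraph, palette, Finset.coe_image, Set.mem_image,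
      Finset.coe_range, Set.mem_Iio]
    exact ⟨fun ⟨j, hj⟩ => ⟨j, j.2, hj⟩, fun ⟨j, hj, h⟩ => ⟨⟨j, hj⟩, h⟩⟩

lemma exists_valid_palette {A : OnlineAlg} (hA : IsProper A) (i r : ℕ) :
    ∃ s, Valid (3 * 4 ^ i) (r * 2 ^ (i + 1)) s ∧
      3 * r * (2 ^ (i + 1) - 1) ≤ (palette A s).card := by
  set L : ℝ := 3 * 4 ^ i with hL
  set ω := r * 2 ^ (i + 1) with hω
  set N := 3 * r * (2 ^ (i + 1) - 1) with hN
  by_contra! hlt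
  have hempty : Valid L ω ⟨0, 0, fun _ => ⟨0, 0, 0⟩⟩ :=
    ⟨fun j hj => absurd hj (Nat.not_lt_zero j), fun j hj => absurd hj (Nat.not_lt_zero j),
      fun l t => by simp [depth]⟩
  obtain ⟨s₀, hs₀, hmin⟩ := (measure fun s => N - (palette A s).card).wf.has_min
    {s | Valid L ω s} ⟨_, hempty⟩
  have hK : ∀ s, Extends s₀ s → Valid L ω s → palette A s ⊆ palette A s₀ := by
    intro s h hs
    have h1 := hmin s hs
    have h2 := hlt s hs
    have h3 := hlt s₀ hs₀
    change ¬ (N - (palette A s).card < N - (palette A s₀).card) at h1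
    rw [Finset.eq_of_subset_of_card_le (h.palette_subset A) (by omega)]
  obtain ⟨t, l, -, ht, -, -, -, hc⟩ := forces_level hA hK r (i + 1)
    (by rw [hL, pow_succ]; linarith [pow_pos (four_pos : (0 : ℝ) < 4) i]) le_rfl s₀
    (Extends.refl s₀) hs₀
  have := Finset.card_le_card (lineColors_subset_palette A t l)
  have := hlt t ht
  omega

end OnlineInterval

theorem stmt14 (i : ℕ) (ω : ℕ) (hω : 0 < ω) (hdvd : 2 ^ (i + 1) ∣ ω)
    (A : OnlineAlg) (hA : IsProper A) :
    ∃ (n : ℕ) (x : Fin n → ℝ × ℝ),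
      (∀ j, 1 ≤ (x j).2 - (x j).1 ∧ (x j).2 - (x j).1 ≤ 3 * 4 ^ i) ∧
      (∀ t : ℝ, {j : Fin n | t ∈ Set.Icc (x j).1 (x j).2}.ncard ≤ ω) ∧
      3 * (1 - (1 : ℝ) / 2 ^ (i + 1)) * (ω : ℝ) ≤
        ((Set.range (onlineColoring A (intervalGraph x))).ncard : ℝ) := by
  obtain ⟨r, rfl⟩ := hdvd
  rw [mul_comm (2 ^ (i + 1)) r]
  obtain ⟨s, hs, hcard⟩ := OnlineInterval.exists_valid_palette hA i r
  obtain ⟨x, h1, h2, h3⟩ := hs.exists_intervals A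
  refine ⟨s.n, x, h1, h2, ?_⟩
  rw [h3]
  have h4 : ((3 * r * (2 ^ (i + 1) - 1) : ℕ) : ℝ) ≤ (OnlineInterval.palette A s).card := by
    exact_mod_cast hcard
  refine le_trans (le_of_eq ?_) h4
  rw [Nat.cast_mul (3 * r), Nat.cast_sub Nat.one_le_two_pow]
  push_cast
  field_simp
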